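/- For every nonzero complex number a, the 7-dimensional complex Lie algebra L(a) with basis e1,...,e7 and nonzero brackets [e2,e7] = a·e3, [e3,e7] = e2, [e4,e7] = e5, [e5,e7] = e4, [e6,e7] = e1 (extended antisymmetrically and bilinearly) is isomorphic as a complex Lie algebra to L(1/a). -/

import Mathlib

/-- The bilinear antisymmetric extension of the bracket relations
`[e2,e7] = a•e3`, `[e3,e7] = e2`, `[e4,e7] = e5`, `[e5,e7] = e4`, `[e6,e7] = e1` (all other
brackets of basis vectors zero) on a 7-dimensional space: the one-parameter family
`G'₍₁₆,₄₎(a)`, written in coordinates. -/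
noncomputable def br (a : ℂ) (x y : Fin 7 → ℂ) : Fin 7 → ℂ :=
  ![x 5 * y 6 - x 6 * y 5,
    x 2 * y 6 - x 6 * y 2,
    a * (x 1 * y 6 - x 6 * y 1),
    x 4 * y 6 - x 6 * y 4,
    x 3 * y 6 - x 6 * y 3,
    0,
    0]

/-- For every nonzero `a : ℂ`, the Lie algebra `L(a) = G'₍₁₆,₄₎(a)` is isomorphic, as a
complex Lie algebra, to `L(1/a)`. -/
theorem G16_4_iso_inv (a : ℂ) (ha : a ≠ 0) :
    ∃ f : (Fin 7 → ℂ) ≃ₗ[ℂ] (Fin 7 → ℂ),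
      ∀ x y : Fin 7 → ℂ, f (br a x y) = br a⁻¹ (f x) (f y) := by
  obtain ⟨s, hs⟩ := IsAlgClosed.exists_pow_nat_eq a (n := 2) two_pos
  have hs0 : s ≠ 0 := by
    rintro rfl
    exact ha (by simpa using hs.symm)
  subst hs
  refine ⟨{
    toFun := fun x => ![s * x 0, s * x 3, x 4, s * x 1, x 2, x 5, s * x 6]
    invFun := fun y => ![s⁻¹ * y 0, s⁻¹ * y 3, y 4, s⁻¹ * y 1, y 2, y 5, s⁻¹ * y 6]
    map_add' := fun x y => by
      ext i
      fin_cases i <;> simp [mul_add]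
    map_smul' := fun c x => by
      ext i
      fin_cases i <;> simp [mul_left_comm]
    left_inv := fun x => by
      ext i
      fin_cases i <;> simp [hs0]
    right_inv := fun x => by
      ext i
      fin_cases i <;> simp [hs0] }, fun x y => ?_⟩
  ext i
  fin_cases i <;> simp [br] <;> field_simp
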